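/- Every nonincreasing parking function a ∈ C_n is a minimal element of the poset (P_n, ≤_*), and { b ∈ P_n : a ≤_* b for some a ∈ C_n } = N_n ∩ D_n. -/

import Mathlib

open scoped Classical

/-- Words on natural numbers (letters are intended to be positive integers). -/
abbrev W : Type := List ℕ

/-- `IsPF a` : the word `a` is a parking function, i.e. all its letters are
positive and its nondecreasing rearrangement `b₁ b₂ ⋯ bₙ` satisfies `bᵢ ≤ i`. -/
def IsPF (a : W) : Prop :=
  (∀ x ∈ a, 1 ≤ x) ∧
    ∀ i, i < a.length → (a.insertionSort (· ≤ ·)).getD i 0 ≤ i + 1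

/-- Split a word into the consecutive segments beginning at its
left-to-right minima (in the order in which they occur in the word). -/
def segs : W → List W
  | [] => []
  | x :: xs =>
      (x :: xs.takeWhile fun y => x ≤ y) :: segs (xs.dropWhile fun y => x ≤ y)
termination_by a => a.length
decreasing_by
  simpa using Nat.lt_succ_of_le (List.dropWhile_sublist _).length_le

/-- The LR-decomposition `F_a` of a word `a`: the sequence of segments beginning
at the left-to-right minima, listed in increasing order of their minimal letters
(i.e. in reverse order of occurrence in `a`). -/
def LR (a : W) : List W := (segs a).reverse

/-- The word `w_k ⋯ w_2 w_1` encoded by an LR-decomposition `(w_1, …, w_k)`. -/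
def wordOf (F : List W) : W := F.reverse.flatten

/-- A word is dominated if it is nonempty and its first letter is its minimal letter. -/
def Dominated (w : W) : Prop := w ≠ [] ∧ ∀ x ∈ w, w.headD 0 ≤ x

/-- The minimal letter of a word (`0` for the empty word). -/
def minW (w : W) : ℕ := (w.min?).getD 0

/-- Add `m` to every letter of a word. -/
def shiftW (m : ℕ) (w : W) : W := w.map (· + m)

/-- Add `m` to every letter of every word of a sequence of words. -/
def shiftF (m : ℕ) (F : List W) : List W := F.map (shiftW m)

/-- The word whose LR-decomposition is the finite set of words `G`:
sort `G` increasingly (for dominated words with distinct minimal letters the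
lexicographic order agrees with comparing the minimal letters) and concatenate
in decreasing order. -/
noncomputable def wordOfSet (G : Finset W) : W := (G.sort (· ≤ ·)).reverse.flatten

/-- Given vertex sets `X`, `Y` (of words) and a set `Θ` of edges, the resulting
set of words: concatenations `u ++ w` over edges `(u, w) ∈ Θ`, together with all
unmatched words of `X` and of `Y`. -/
noncomputable def glueSet (X Y : Finset W) (Θ : Finset (W × W)) : Finset W :=
  Θ.image (fun p => p.1 ++ p.2) ∪
    X.filter (fun u => ∀ p ∈ Θ, p.1 ≠ u) ∪
    Y.filter (fun w => ∀ p ∈ Θ, p.2 ≠ w)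

/-- `R(a,b)` : the set of matchings between `F_a` and `F_b + m` (`m` the length
of `a`), encoded as sets of edges in which no vertex occurs twice. -/
noncomputable def Rset (a b : W) : Finset (Finset (W × W)) :=
  ((LR a).toFinset ×ˢ (shiftF a.length (LR b)).toFinset).powerset.filter
    (fun Θ => ∀ p ∈ Θ, ∀ q ∈ Θ, (p.1 = q.1 ∨ p.2 = q.2) → p = q)

/-- `aΘb` : the parking function whose LR-decomposition consists of the
concatenations `u ⬝ (w + m)` over the edges `(u, w + m)` of `Θ` together with all
unmatched words of `F_a` and of `F_b + m`. -/
noncomputable def mTheta (a b : W) (Θ : Finset (W × W)) : W :=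
  wordOfSet (glueSet (LR a).toFinset (shiftF a.length (LR b)).toFinset Θ)

/-- `d(a) = min { i : #{ j : a_j ≤ i } < i }`. -/
def dVal (a : W) : ℕ :=
  Nat.find (p := fun i => (a.filter (fun x => x ≤ i)).length < i)
    ⟨a.length + 1, Nat.lt_succ_of_le (List.length_filter_le _ _)⟩

/-- One step of the parkization algorithm: decrement every letter greater
than `d(a)`.  (This is the identity when `a` is a parking function.) -/
def parkStep (a : W) : W := a.map fun x => if dVal a < x then x - 1 else x

/-- Auxiliary fueled version of the parkization algorithm. -/
def parkFuel : ℕ → W → W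
  | 0, a => a
  | k + 1, a => if dVal a = a.length + 1 then a else parkFuel k (parkStep a)

/-- The parkization `Park a` of a word `a`.  (For a word with positive letters
the algorithm needs at most `a.sum` steps, so the fuel below suffices.) -/
def Park (a : W) : W := parkFuel a.sum a

/-- The subword of `a` obtained by keeping exactly the words of `F_a`
belonging to `S`. -/
def subWord (a : W) (S : Finset W) : W := wordOf ((LR a).filter (· ∈ S))

/-- The free module with basis indexed by words; the Hopf algebra `PFSym` is
its submodule spanned by `{M_a : a ∈ P}`. -/
abbrev FW (K : Type) [Field K] : Type := W →₀ K

/-- The monomial basis element `M_a`. -/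
noncomputable def Mb (K : Type) [Field K] (a : W) : FW K := Finsupp.single a 1

/-- `M_a ⋆ M_b = Σ_{Θ ∈ R(a,b)} M_{aΘb}` on basis elements. -/
noncomputable def mulSingle (K : Type) [Field K] (a b : W) : FW K :=
  ∑ Θ ∈ Rset a b, Mb K (mTheta a b Θ)

/-- The product `⋆`, extended bilinearly. -/
noncomputable def starF (K : Type) [Field K] (x y : FW K) : FW K :=
  x.sum fun a ca => y.sum fun b cb => (ca * cb) • mulSingle K a b

/-- The free module with basis indexed by pairs of words; it realizes the
tensor square of `FW K` via `M_a ⊗ M_b ↦ single (a,b)`. -/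
abbrev FW2 (K : Type) [Field K] : Type := (W × W) →₀ K

/-- `Δ(M_a) = Σ M_{Park a'} ⊗ M_{Park a''}` over ordered pairs `(a', a'')` of
subwords of `a` with `F_{a'} ⊍ F_{a''} = F_a` (encoded by the subset
`S ⊆ F_a` of words kept in `a'`). -/
noncomputable def deltaSingle (K : Type) [Field K] (a : W) : FW2 K :=
  ∑ S ∈ ((LR a).toFinset).powerset,
    Finsupp.single
      (Park (subWord a S), Park (subWord a (((LR a).toFinset) \ S))) 1

/-- The coproduct `Δ`, extended linearly. -/
noncomputable def deltaF (K : Type) [Field K] (x : FW K) : FW2 K :=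
  x.sum fun a ca => ca • deltaSingle K a

/-- The componentwise product on the tensor square, on basis elements:
`(M_a ⊗ M_b) ⋆ (M_c ⊗ M_d) = (M_a ⋆ M_c) ⊗ (M_b ⋆ M_d)`. -/
noncomputable def star2Single (K : Type) [Field K] (p q : W × W) : FW2 K :=
  ∑ Θ ∈ Rset p.1 q.1, ∑ Θ' ∈ Rset p.2 q.2,
    Finsupp.single (mTheta p.1 q.1 Θ, mTheta p.2 q.2 Θ') 1

/-- The componentwise product on the tensor square, extended bilinearly. -/
noncomputable def star2F (K : Type) [Field K] (x y : FW2 K) : FW2 K :=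
  x.sum fun p cp => y.sum fun q cq => (cp * cq) • star2Single K p q

/-- The counit `ε` on basis elements. -/
noncomputable def epsW (K : Type) [Field K] (a : W) : K := if a = [] then 1 else 0

/-- `F_a ∘ F_b` : concatenate the `i`-th words of `F_a` and `F_b + m`
for `i ≤ min(r,s)` and keep the remaining unpaired words. -/
def splitLR (F G : List W) : List W :=
  List.zipWith (· ++ ·) F G ++ F.drop G.length ++ G.drop F.length

/-- The split product `a ∘ b`. -/
def splitProd (a b : W) : W := wordOf (splitLR (LR a) (shiftF a.length (LR b)))

/-- A nonempty parking function is unsplitable if it is not the split product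
of two nonempty parking functions. -/
def UnsplitablePF (a : W) : Prop :=
  IsPF a ∧ a ≠ [] ∧
    ¬ ∃ b c : W, IsPF b ∧ IsPF c ∧ b ≠ [] ∧ c ≠ [] ∧ a = splitProd b c

/-- The slash product `a | b = (b₁+m) ⋯ (bₙ+m) a₁ ⋯ a_m`. -/
def slashProd (a b : W) : W := shiftW a.length b ++ a

/-- A nonempty parking function is atomic if it is not the slash product
of two nonempty parking functions. -/
def AtomicPF (a : W) : Prop :=
  IsPF a ∧ a ≠ [] ∧
    ¬ ∃ b c : W, IsPF b ∧ IsPF c ∧ b ≠ [] ∧ c ≠ [] ∧ a = slashProd b c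

/-- `u ≺* v` : either `v` is a proper initial subword of `u`, or `u` is not a
proper initial subword of `v` and `u` precedes `v` lexicographically. -/
def precStar (u v : W) : Prop :=
  (v <+: u ∧ v ≠ u) ∨ (¬ (u <+: v ∧ u ≠ v) ∧ List.Lex (· < ·) u v)

/-- `a ≺*_lex b` : `F_a` strictly precedes `F_b` in the lexicographic order
on sequences of words induced by `≺*`. -/
def precStarLex (a b : W) : Prop := List.Lex precStar (LR a) (LR b)

/-- The covering relation of `≤_*` : `b` covers `a` if `F_b` is obtained from
`F_a = (w_1, …, w_r)` by replacing `w_i` by `w_i ⬝ w_j` and removing `w_j`,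
for some `i < j` such that every letter of `w_i` is at most every letter of `w_j`. -/
def CovStar (a b : W) : Prop :=
  ∃ i j, i < j ∧ j < (LR a).length ∧
    (∀ x ∈ (LR a).getD i [], ∀ y ∈ (LR a).getD j [], x ≤ y) ∧
    LR b = ((LR a).set i ((LR a).getD i [] ++ (LR a).getD j [])).eraseIdx j

/-- The partial order `≤_*` on parking functions, generated by the covering
relations. -/
def leStar (a b : W) : Prop := Relation.ReflTransGen CovStar a b

/-- The finite set of all parking functions of length `n`. -/
noncomputable def pfFinset (n : ℕ) : Finset W :=
  ((Finset.univ : Finset (Fin n → Fin n)).image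
      (fun f => List.ofFn fun i => (f i).val + 1)).filter IsPF

/-- The basis element `Q_a = Σ_{a ≤_* b} M_b`. -/
noncomputable def Qb (K : Type) [Field K] (a : W) : FW K :=
  ∑ b ∈ (pfFinset a.length).filter (fun b => leStar a b), Mb K b

/-- `Q_x ⊗ Q_y` as an element of the tensor square. -/
noncomputable def QT (K : Type) [Field K] (x y : W) : FW2 K :=
  ∑ b ∈ (pfFinset x.length).filter (fun b => leStar x b),
    ∑ c ∈ (pfFinset y.length).filter (fun c => leStar y c),
      Finsupp.single (b, c) 1

/-- `a` is a nonincreasing word. -/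
def NonInc (a : W) : Prop := a.Chain' (fun x y => y ≤ x)

/-- Every word of the LR-decomposition of `a` is nondecreasing. -/
def Nprop (a : W) : Prop := ∀ w ∈ LR a, w.Chain' (· ≤ ·)

/-- The words of the LR-decomposition of `a` have pairwise disjoint sets of letters. -/
def Dprop (a : W) : Prop := (LR a).Pairwise (fun u v => ∀ x ∈ u, x ∉ v)

/-- `a` is a permutation of `{1, …, n}` viewed as a word. -/
def Sprop (a : W) : Prop := a.Perm (List.range' 1 a.length)



def hd16 (w : W) : ℕ := w.headD 0

/-- Validity of an LR-decomposition. -/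
def Good16 (F : List W) : Prop :=
  (∀ w ∈ F, Dominated w) ∧ F.Pairwise (fun u v => hd16 u < hd16 v)

theorem segs_flatten16 (a : W) : (segs a).flatten = a := by
  induction a using segs.induct with
  | case1 => simp [segs]
  | case2 x xs ih =>
    rw [segs, List.flatten_cons, ih, List.cons_append, List.takeWhile_append_dropWhile]

theorem segs_dom16 (a : W) : ∀ w ∈ segs a, Dominated w := by
  induction a using segs.induct with
  | case1 => simp [segs]
  | case2 x xs ih =>
    rw [segs]
    intro w hw
    rcases List.mem_cons.1 hw with rfl | hw
    · refine ⟨by simp, ?_⟩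
      intro y hy
      rcases List.mem_cons.1 hy with rfl | hy
      · simp
      · simpa using List.mem_takeWhile_imp hy
    · exact ih w hw

theorem segs_hd16 (a : W) : ∀ w ∈ segs a, hd16 w ≤ hd16 a := by
  induction a using segs.induct with
  | case1 => simp [segs]
  | case2 x xs ih =>
    rw [segs]
    intro w hw
    rcases List.mem_cons.1 hw with rfl | hw
    · simp [hd16]
    · refine (ih w hw).trans ?_
      cases h : xs.dropWhile (fun y => decide (x ≤ y)) with
      | nil => simp [hd16]
      | cons y t =>
        have := List.head_dropWhile_not (fun y => decide (x ≤ y)) (l := xs) (by simp [h])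
        simp [h] at this
        simp [hd16]; omega

theorem segs_pw16 (a : W) : (segs a).Pairwise (fun u v => hd16 v < hd16 u) := by
  induction a using segs.induct with
  | case1 => simp [segs]
  | case2 x xs ih =>
    rw [segs]
    refine List.pairwise_cons.2 ⟨?_, ih⟩
    intro w hw
    have h1 := segs_hd16 _ w hw
    cases h : xs.dropWhile (fun y => decide (x ≤ y)) with
    | nil => rw [h] at hw; simp [segs] at hw
    | cons y t =>
      have := List.head_dropWhile_not (fun y => decide (x ≤ y)) (l := xs) (by simp [h])
      simp [h] at this
      rw [h] at h1
      simp [hd16] at *; omega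

theorem LR_good16 (a : W) : Good16 (LR a) := by
  refine ⟨fun w hw => segs_dom16 a w (by simpa [LR] using hw), ?_⟩
  rw [LR, List.pairwise_reverse]; exact segs_pw16 a

theorem wordOf_LR16 (a : W) : wordOf (LR a) = a := by
  simp [wordOf, LR, segs_flatten16]

theorem takeWhile16 (p : ℕ → Bool) (t s : List ℕ) (ht : ∀ y ∈ t, p y = true)
    (hs : ∀ y ∈ s.head?, p y = false) :
    (t ++ s).takeWhile p = t ∧ (t ++ s).dropWhile p = s := by
  induction t with
  | nil =>
    cases s with
    | nil => simp
    | cons y s => simp at hs; simp [hs]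
  | cons z t ih =>
    have := ih (fun y hy => ht y (by simp [hy]))
    have hz := ht z (by simp)
    simp [hz, this]

theorem segs_of16 (G : List W) (h1 : ∀ w ∈ G, Dominated w)
    (h2 : G.Pairwise (fun u v => hd16 v < hd16 u)) : segs G.flatten = G := by
  induction G with
  | nil => simp [segs]
  | cons w G ih =>
    have hG := ih (fun v hv => h1 v (by simp [hv])) (List.pairwise_cons.1 h2).2
    obtain ⟨hw, hm⟩ := h1 w (by simp)
    cases w with
    | nil => exact absurd rfl hw
    | cons x t =>
      have key := takeWhile16 (fun y => decide (x ≤ y)) t G.flatten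
        (by intro y hy; simpa using hm y (by simp [hy]))
        (by
          cases G with
          | nil => simp
          | cons v G =>
            have h3 := (List.pairwise_cons.1 h2).1 v (by simp)
            have h4 := (h1 v (by simp)).1
            cases v with
            | nil => exact absurd rfl h4
            | cons z v => simpa [hd16] using h3)
      rw [List.flatten_cons, List.cons_append, segs, key.1, key.2, hG]

theorem LR_wordOf16 (F : List W) (h : Good16 F) : LR (wordOf F) = F := by
  rw [LR, wordOf, segs_of16]
  · simp
  · intro w hw; exact h.1 w (by simpa using hw)
  · rw [List.pairwise_reverse]; exact h.2

theorem cov16 (a b : W) : CovStar a b ↔ ∃ L u M v R, LR a = L ++ u :: (M ++ v :: R) ∧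
    LR b = L ++ (u ++ v) :: (M ++ R) ∧ ∀ x ∈ u, ∀ y ∈ v, x ≤ y := by
  have aux : ∀ (L : List W) u M v R,
    ((L ++ u :: (M ++ v :: R)).getD L.length [] = u) ∧
    ((L ++ u :: (M ++ v :: R)).getD (L.length + (M.length + 1)) [] = v) ∧
    (((L ++ u :: (M ++ v :: R)).set L.length (u ++ v)).eraseIdx (L.length + (M.length + 1))
      = L ++ (u ++ v) :: (M ++ R)) := by
    intro L u M v R
    refine ⟨by simp, by simp [List.getD_eq_getElem?_getD], ?_⟩
    rw [List.set_append_right _ _ (le_refl _), Nat.sub_self, List.set_cons_zero,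
      List.eraseIdx_append_of_length_le (by omega), Nat.add_sub_cancel_left, List.eraseIdx_cons_succ,
      List.eraseIdx_append_of_length_le (by omega), Nat.sub_self, List.eraseIdx_cons_zero]
  constructor
  · rintro ⟨i, j, hij, hj, hle, hb⟩
    obtain ⟨L, u, M, v, R, hF, rfl, rfl⟩ : ∃ L u M v R, LR a = L ++ u :: (M ++ v :: R) ∧
        L.length = i ∧ L.length + (M.length + 1) = j := by
      refine ⟨(LR a).take i, (LR a)[i], ((LR a).drop (i+1)).take (j - i - 1), (LR a)[j],
        (LR a).drop (j+1), ?_, ?_, ?_⟩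
      · have e1 : (LR a)[j] :: (LR a).drop (j+1) = ((LR a).drop (i+1)).drop (j - i - 1) := by
          rw [List.drop_drop, ← List.drop_eq_getElem_cons]; congr 1; omega
        rw [e1, List.take_append_drop, ← List.drop_eq_getElem_cons, List.take_append_drop]
      · simp; omega
      · simp; omega
    obtain ⟨h1, h2, h3⟩ := aux L u M v R
    rw [hF, h1, h2] at hle hb
    exact ⟨L, u, M, v, R, hF, by rw [hb, h3], hle⟩
  · rintro ⟨L, u, M, v, R, hF, hb, hle⟩
    obtain ⟨h1, h2, h3⟩ := aux L u M v R
    refine ⟨L.length, L.length + (M.length + 1), by omega, ?_, ?_, ?_⟩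
    · rw [hF]; simp
    · rw [hF, h1, h2]; exact hle
    · rw [hF, h1, h2, hb, h3]

/-- All letters equal. -/
def Const16 (w : W) : Prop := ∀ x ∈ w, ∀ y ∈ w, x = y

theorem nonInc_iff16 (a : W) : NonInc a ↔ a.Pairwise (fun x y => y ≤ x) := by
  haveI : IsTrans ℕ (fun x y => y ≤ x) := ⟨fun a b c h1 h2 => h2.trans h1⟩
  exact List.isChain_iff_pairwise

theorem nondec_iff16 (a : W) : a.Chain' (· ≤ ·) ↔ a.Pairwise (· ≤ ·) :=
  List.isChain_iff_pairwise

theorem const_of16 (a : W) (h : NonInc a) : ∀ w ∈ LR a, Const16 w := by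
  rw [nonInc_iff16] at h
  intro w hw
  obtain ⟨h1, h2⟩ := (LR_good16 a).1 w hw
  rw [← segs_flatten16 a] at h
  have hp := (List.pairwise_flatten.1 h).1 w (by simpa [LR] using hw)
  cases w with
  | nil => exact absurd rfl h1
  | cons x t =>
    have key : ∀ y ∈ x :: t, y = x := by
      intro y hy
      have := h2 y hy
      have h3 := (List.pairwise_cons.1 hp).1 y
      simp at this hy
      rcases hy with rfl | hy
      · rfl
      · exact le_antisymm (h3 hy) this
    intro y hy z hz
    rw [key y hy, key z hz]

theorem hd_mem16 {w : W} (h : w ≠ []) : hd16 w ∈ w := by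
  cases w with
  | nil => exact absurd rfl h
  | cons x t => simp [hd16]

theorem nonInc_of16 (F : List W) (hF : Good16 F) (hc : ∀ w ∈ F, Const16 w) :
    NonInc (wordOf F) := by
  rw [nonInc_iff16, wordOf, List.pairwise_flatten]
  constructor
  · intro w hw
    have := hc w (by simpa using hw)
    exact List.Pairwise.imp_of_mem (fun {x y} hx hy _ => (this y hy x hx).le)
      (List.pairwise_of_forall (R := fun _ _ : ℕ => True) (by simp))
  · rw [List.pairwise_reverse]
    refine List.Pairwise.imp_of_mem ?_ hF.2
    intro u v hu hv huv x hx y hy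
    rw [hc v hv x hx _ (hd_mem16 (hF.1 v hv).1), hc u hu y hy _ (hd_mem16 (hF.1 u hu).1)]
    exact huv.le

theorem dom_hd16 {w : W} (h : Dominated w) : ∀ x ∈ w, hd16 w ≤ x := h.2

theorem minimal16 (a b : W) (h : NonInc a) (hb : leStar b a) : b = a := by
  rcases Relation.ReflTransGen.cases_tail hb with h1 | ⟨c, -, hc⟩
  · exact h1.symm
  · exfalso
    obtain ⟨L, u, M, v, R, hF, hb, hle⟩ := (cov16 c a).1 hc
    have hg := LR_good16 c
    rw [hF] at hg
    have hu := hd_mem16 (hg.1 u (by simp)).1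
    have hv := hd_mem16 (hg.1 v (by simp)).1
    have hlt : hd16 u < hd16 v := by
      have := (List.pairwise_append.1 hg.2).2.1
      exact (List.pairwise_cons.1 this).1 v (by simp)
    have := const_of16 a h (u ++ v) (by rw [hb]; simp) _ (List.mem_append_left _ hu) _
      (List.mem_append_right _ hv)
    omega

theorem up16 (a b : W) (hN : Nprop a) (hD : Dprop a) (h : CovStar a b) : Nprop b ∧ Dprop b := by
  obtain ⟨L, u, M, v, R, hF, hb, hle⟩ := (cov16 a b).1 h
  unfold Nprop Dprop at *
  simp only [nondec_iff16] at *
  rw [hF] at hN hD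
  rw [hb]
  constructor
  · intro w hw
    have : w = u ++ v ∨ w ∈ L ++ u :: (M ++ v :: R) := by
      simp at hw ⊢; tauto
    rcases this with rfl | h
    · exact List.pairwise_append.2 ⟨hN u (by simp), hN v (by simp), hle⟩
    · exact hN w h
  · simp only [List.pairwise_append, List.pairwise_cons, List.mem_append, List.mem_cons] at hD ⊢
    grind

theorem split16 (w : W) (hs : w.Pairwise (· ≤ ·)) (hc : ¬ Const16 w) :
    ∃ u v, w = u ++ v ∧ u ≠ [] ∧ v ≠ [] ∧ ∀ x ∈ u, ∀ y ∈ v, x < y := by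
  induction w with
  | nil => exact absurd (by simp [Const16]) hc
  | cons x t ih =>
    rw [List.pairwise_cons] at hs
    cases t with
    | nil => exact absurd (by simp [Const16]) hc
    | cons y t =>
      by_cases hxy : x < y
      · refine ⟨[x], y :: t, rfl, by simp, by simp, ?_⟩
        have := (List.pairwise_cons.1 hs.2).1
        intro a ha b hb
        simp at ha hb
        rcases hb with rfl | hb
        · omega
        · have := this b hb; omega
      · have hxy' : x = y := le_antisymm (hs.1 y (by simp)) (not_lt.1 hxy)
        subst hxy'
        obtain ⟨u, v, h1, h2, h3, h4⟩ := ih hs.2 (by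
          intro h; apply hc
          intro a ha b hb
          exact h a (by simpa using ha) b (by simpa using hb))
        refine ⟨x :: u, v, by simp [h1], by simp, h3, ?_⟩
        intro a ha b hb
        rcases List.mem_cons.1 ha with rfl | ha
        · cases u with
          | nil => exact absurd rfl h2
          | cons z u =>
            simp at h1
            exact h4 a (by simp [h1]) b hb
        · exact h4 a ha b hb

theorem insert16 (M : List W) (h : M.Pairwise (fun u v => hd16 u < hd16 v)) (c : ℕ) :
    ∃ A B, M = A ++ B ∧ (∀ w ∈ A, hd16 w < c) ∧ ∀ w ∈ B, c ≤ hd16 w := by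
  induction M with
  | nil => exact ⟨[], [], by simp⟩
  | cons w M ih =>
    rw [List.pairwise_cons] at h
    by_cases hw : hd16 w < c
    · obtain ⟨A, B, h1, h2, h3⟩ := ih h.2
      exact ⟨w :: A, B, by simp [h1], by simpa using ⟨hw, h2⟩, h3⟩
    · refine ⟨[], w :: M, rfl, by simp, ?_⟩
      intro v hv
      rcases List.mem_cons.1 hv with rfl | hv
      · omega
      · have := h.1 v hv; omega

theorem down16 (b : W) (hN : Nprop b) (hD : Dprop b) (h : ¬ NonInc b) :
    ∃ a, CovStar a b ∧ Nprop a ∧ Dprop a ∧ (LR a).length = (LR b).length + 1 ∧ a.Perm b := by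
  have hg := LR_good16 b
  obtain ⟨w, hw, hc⟩ : ∃ w ∈ LR b, ¬ Const16 w := by
    by_contra! hcon
    exact h (wordOf_LR16 b ▸ nonInc_of16 _ hg hcon)
  have hs := (nondec_iff16 w).1 (hN w hw)
  obtain ⟨u, v, rfl, hu, hv, huv⟩ := split16 w hs hc
  obtain ⟨L, M', hF⟩ := List.append_of_mem hw
  have hg' := hg
  rw [hF] at hg'
  have hpw := hg'.2
  obtain ⟨M, R, rfl, hM, hR⟩ := insert16 M'
    (List.pairwise_cons.1 (List.pairwise_append.1 hpw).2.1).2 (hd16 v)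
  have hdw := hg'.1 (u ++ v) (by simp)
  have hhu : hd16 (u ++ v) = hd16 u := by
    cases u with
    | nil => exact absurd rfl hu
    | cons x t => simp [hd16]
  have hN' := hN
  have hD' := hD
  unfold Nprop at hN'
  unfold Dprop at hD'
  simp only [nondec_iff16] at hN'
  rw [hF] at hN' hD'
  have hsu : u.Pairwise (· ≤ ·) := (List.pairwise_append.1 hs).1
  have hsv : v.Pairwise (· ≤ ·) := (List.pairwise_append.1 hs).2.1
  have hmu := hd_mem16 hu
  have hmv := hd_mem16 hv
  have hlt := huv _ hmu _ hmv
  have hdu : Dominated u := ⟨hu, fun x hx => by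
    have := hdw.2 x (by simp [hx])
    change hd16 (u ++ v) ≤ x at this
    rw [hhu] at this; exact this⟩
  have hdv : Dominated v := ⟨hv, fun x hx => by
    cases v with
    | nil => exact absurd rfl hv
    | cons z v =>
      rcases List.mem_cons.1 hx with rfl | hx
      · simp
      · simpa using (List.pairwise_cons.1 hsv).1 x hx⟩
  have hR' : ∀ w ∈ R, hd16 v < hd16 w := by
    intro w hw
    refine lt_of_le_of_ne (hR w hw) ?_
    intro he
    have h1 := (List.pairwise_cons.1 (List.pairwise_append.1 hD').2.1).1 w (by simp [hw]) (hd16 v)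
      (by simp [hmv])
    rw [he] at h1
    exact h1 (hd_mem16 (hg'.1 w (by simp [hw])).1)
  have hgood : Good16 (L ++ u :: (M ++ v :: R)) := by
    constructor
    · intro w hw
      have : w = u ∨ w = v ∨ w ∈ L ++ (u ++ v) :: (M ++ R) := by simp at hw ⊢; tauto
      rcases this with rfl | rfl | h
      · exact hdu
      · exact hdv
      · exact hg'.1 w h
    · simp only [List.pairwise_append, List.pairwise_cons, List.mem_append, List.mem_cons, hhu]
        at hpw ⊢
      grind
  have hLR := LR_wordOf16 _ hgood
  refine ⟨wordOf (L ++ u :: (M ++ v :: R)), ?_, ?_, ?_, ?_, ?_⟩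
  · rw [cov16]
    exact ⟨L, u, M, v, R, hLR, hF, fun x hx y hy => (huv x hx y hy).le⟩
  · unfold Nprop
    rw [hLR]
    simp only [nondec_iff16]
    intro w hw
    have : w = u ∨ w = v ∨ w ∈ L ++ (u ++ v) :: (M ++ R) := by simp at hw ⊢; tauto
    rcases this with rfl | rfl | h
    · exact hsu
    · exact hsv
    · exact hN' w h
  · unfold Dprop
    rw [hLR]
    simp only [List.pairwise_append, List.pairwise_cons, List.mem_append, List.mem_cons] at hD' ⊢
    grind
  · rw [hLR, hF]; simp; omega
  · rw [← wordOf_LR16 b, hF]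
    rw [List.perm_iff_count]
    intro x
    simp [wordOf, List.count_append]
    omega

theorem IsPF_perm16 {a b : W} (h : a.Perm b) (hb : IsPF b) : IsPF a := by
  have e : a.insertionSort (· ≤ ·) = b.insertionSort (· ≤ ·) :=
    List.Perm.eq_of_pairwise' (r := (· ≤ ·)) (List.pairwise_insertionSort _ _)
      (List.pairwise_insertionSort _ _)
      ((List.perm_insertionSort _ _).trans (h.trans (List.perm_insertionSort _ _).symm))
  refine ⟨fun x hx => hb.1 x (h.mem_iff.1 hx), fun i hi => ?_⟩
  rw [e]; exact hb.2 i (h.length_eq ▸ hi)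

theorem len16 (F : List W) (h : ∀ w ∈ F, w ≠ []) : F.length ≤ F.flatten.length := by
  induction F with
  | nil => simp
  | cons w F ih =>
    have h1 := ih (fun v hv => h v (by simp [hv]))
    have h2 := List.length_pos_iff.2 (h w (by simp))
    simp only [List.flatten_cons, List.length_append, List.length_cons]
    omega

theorem LRlen16 (a : W) : (LR a).length ≤ a.length := by
  have := len16 (segs a) (fun w hw => (segs_dom16 a w hw).1)
  rwa [segs_flatten16, ← List.length_reverse] at this

theorem exists16 (k : ℕ) : ∀ b : W, b.length - (LR b).length = k → Nprop b → Dprop b →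
    ∃ a, NonInc a ∧ leStar a b ∧ a.Perm b := by
  induction k with
  | zero =>
    intro b hk hN hD
    by_cases h : NonInc b
    · exact ⟨b, h, Relation.ReflTransGen.refl, List.Perm.refl _⟩
    · obtain ⟨a, -, -, -, h1, h2⟩ := down16 b hN hD h
      have := LRlen16 a
      have := h2.length_eq
      omega
  | succ k ih =>
    intro b hk hN hD
    by_cases h : NonInc b
    · exact ⟨b, h, Relation.ReflTransGen.refl, List.Perm.refl _⟩
    · obtain ⟨a, hc, hN', hD', h1, h2⟩ := down16 b hN hD h
      have := h2.length_eq
      obtain ⟨c, h3, h4, h5⟩ := ih a (by omega) hN' hD'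
      exact ⟨c, h3, Relation.ReflTransGen.tail h4 hc, h5.trans h2⟩

theorem base16 (a : W) (h : NonInc a) : Nprop a ∧ Dprop a := by
  have hc := const_of16 a h
  have hg := LR_good16 a
  constructor
  · intro w hw
    rw [nondec_iff16]
    have := hc w hw
    exact List.Pairwise.imp_of_mem (fun {x y} hx hy _ => (this x hx y hy).le)
      (List.pairwise_of_forall (R := fun _ _ : ℕ => True) (by simp))
  · refine List.Pairwise.imp_of_mem ?_ hg.2
    intro u v hu hv huv x hx hxv
    have h1 := hc u hu x hx _ (hd_mem16 (hg.1 u hu).1)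
    have h2 := hc v hv x hxv _ (hd_mem16 (hg.1 v hv).1)
    omega

/-- Every nonincreasing parking function is a minimal element
of `(P_n, ≤_*)`, and the set of elements of `P_n` lying above some nonincreasing
parking function is exactly `N_n ∩ D_n`. -/
theorem stmt16 (n : ℕ) :
    (∀ a : W, IsPF a → a.length = n → NonInc a →
      ∀ b : W, IsPF b → b.length = n → leStar b a → b = a) ∧
    {b : W | IsPF b ∧ b.length = n ∧
        ∃ a : W, IsPF a ∧ a.length = n ∧ NonInc a ∧ leStar a b} =
      {b : W | IsPF b ∧ b.length = n ∧ Nprop b ∧ Dprop b} := by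
  refine ⟨fun a _ _ h b _ _ hb => minimal16 a b h hb, ?_⟩
  ext b
  constructor
  · rintro ⟨h1, h2, a, -, -, h3, h4⟩
    refine ⟨h1, h2, ?_⟩
    clear h1 h2
    induction h4 with
    | refl => exact base16 a h3
    | tail _ hc ih => exact up16 _ _ ih.1 ih.2 hc
  · rintro ⟨h1, h2, h3, h4⟩
    obtain ⟨a, h5, h6, h7⟩ := exists16 _ b rfl h3 h4
    exact ⟨h1, h2, a, IsPF_perm16 h7 h1, h7.length_eq.trans h2, h5, h6⟩
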